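/- arXiv:2211.11101 — 5 statements merged into one kernel-verified Lean document; each statement's English description precedes it below -/
import Mathlib

section
/- Let Δ^n = {x : {0,…,n} → [0,1] : ∑_i x(i) = 1} denote the standard n-simplex, and let φ : {0,…,n+1} → {0,…,n} be a surjection, inducing the affine map p : Δ^{n+1} → Δ^n defined by p(x)(j) = ∑_{φ(i)=j} x(i). Then for every topological embedding f : [0,1]^n → Δ^n whose image lies in the interior of Δ^n (the set of points all of whose coordinates are positive), there exists a topological embedding F : [0,1]^{n+1} → Δ^{n+1} whose image lies in the interior of Δ^{n+1} and such that p ∘ F = f ∘ π, where π : [0,1]^{n+1} → [0,1]^n is the projection forgetting the last coordinate. -/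
open unitInterval

/-- if `φ : {0,…,n+1} → {0,…,n}` is a surjection inducing the affine map
`p : Δ^{n+1} → Δ^n`, `p(x)(j) = ∑_{φ(i)=j} x(i)`, then every topological embedding
`f : [0,1]^n → Δ^n` with image in the interior of `Δ^n` lifts to a topological embedding
`F : [0,1]^{n+1} → Δ^{n+1}` with image in the interior of `Δ^{n+1}` such that
`p ∘ F = f ∘ π`, where `π` forgets the last coordinate. -/
theorem embedding_lifts_through_simplicial_surjection (n : ℕ)
    (φ : Fin (n + 2) → Fin (n + 1)) (hφ : Function.Surjective φ)
    (f : (Fin n → I) → stdSimplex ℝ (Fin (n + 1)))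
    (hf : Topology.IsEmbedding f)
    (hfint : ∀ x i, 0 < (f x).1 i) :
    ∃ F : (Fin (n + 1) → I) → stdSimplex ℝ (Fin (n + 2)),
      Topology.IsEmbedding F ∧
      (∀ x i, 0 < (F x).1 i) ∧
      ∀ x j, (∑ i ∈ Finset.univ.filter (fun i => φ i = j), (F x).1 i)
        = (f (fun k => x k.castSucc)).1 j := by
  have hni : ¬ Function.Injective φ := by
    intro h
    have := Fintype.card_le_of_injective φ h
    simp at this
  obtain ⟨a, b, hab, hne⟩ : ∃ a b, φ a = φ b ∧ a ≠ b := by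
    simpa [Function.Injective] using hni
  let g : Fin (n + 2) → (Fin (n + 1) → I) → ℝ :=
    fun k x => 1 + if k = a then (x (Fin.last n) : ℝ) else 0
  have hg : ∀ k x, 0 < g k x := by
    intro k x
    have := (x (Fin.last n)).2.1
    simp only [g]
    split_ifs <;> linarith
  have hgc : ∀ k, Continuous (g k) := by
    intro k
    simp only [g]
    split_ifs <;> fun_prop
  let S : Fin (n + 1) → (Fin (n + 1) → I) → ℝ :=
    fun j x => ∑ k ∈ Finset.univ.filter (fun i => φ i = j), g k x
  have hS : ∀ j x, 0 < S j x := by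
    intro j x
    obtain ⟨i, hi⟩ := hφ j
    exact Finset.sum_pos (fun k _ => hg k x) ⟨i, by simp [hi]⟩
  have hSc : ∀ j, Continuous (S j) := fun j => continuous_finsetSum _ fun k _ => hgc k
  let π : (Fin (n + 1) → I) → (Fin n → I) := fun x k => x k.castSucc
  have hπ : Continuous π := by fun_prop
  let G : (Fin (n + 1) → I) → Fin (n + 2) → ℝ :=
    fun x i => g i x / S (φ i) x * (f (π x)).1 (φ i)
  have hG : ∀ x i, 0 < G x i := fun x i =>
    mul_pos (div_pos (hg i x) (hS _ x)) (hfint _ _)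
  have hsum : ∀ x j, (∑ i ∈ Finset.univ.filter (fun i => φ i = j), G x i)
      = (f (π x)).1 j := by
    intro x j
    have h1 : (∑ i ∈ Finset.univ.filter (fun i => φ i = j), G x i)
        = ∑ i ∈ Finset.univ.filter (fun i => φ i = j), g i x * ((f (π x)).1 j / S j x) := by
      refine Finset.sum_congr rfl fun i hi => ?_
      have hi' : φ i = j := by simpa using hi
      simp only [G, hi']
      ring
    rw [h1, ← Finset.sum_mul]
    exact mul_div_cancel₀ _ (hS j x).ne'
  have hGs : ∀ x, G x ∈ stdSimplex ℝ (Fin (n + 2)) := by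
    intro x
    refine ⟨fun i => (hG x i).le, ?_⟩
    rw [← Finset.sum_fiberwise Finset.univ φ (G x)]
    simp only [hsum]
    exact (f (π x)).2.2
  have hGc : Continuous G := by
    refine continuous_pi fun i => ?_
    refine ((hgc i).div (hSc _) fun x => (hS _ x).ne').mul ?_
    exact (continuous_apply (φ i)).comp
      (continuous_subtype_val.comp (hf.continuous.comp hπ))
  have hGi : Function.Injective G := by
    intro x y hxy
    have hf' : f (π x) = f (π y) := by
      apply Subtype.ext
      funext j
      rw [← hsum x j, ← hsum y j, hxy]
    have hp : π x = π y := hf.injective hf'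
    have ha := congrFun hxy a
    have hb := congrFun hxy b
    simp only [G, hf', hab] at ha hb
    have hc := (hfint (π y) (φ b)).ne'
    have ha := mul_right_cancel₀ hc ha
    have hb := mul_right_cancel₀ hc hb
    have gb : ∀ z, g b z = 1 := fun z => by simp [g, hne.symm]
    rw [gb, gb, one_div, one_div, inv_inj] at hb
    rw [hb, div_left_inj' (hS _ y).ne'] at ha
    have ht : x (Fin.last n) = y (Fin.last n) := by
      apply Subtype.ext
      simpa [g] using ha
    funext k
    refine Fin.lastCases ht (fun i => ?_) k
    exact congrFun hp i
  refine ⟨fun x => ⟨G x, hGs x⟩, ?_, hG, hsum⟩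
  refine (Continuous.isClosedEmbedding (hGc.subtype_mk hGs) ?_).isEmbedding
  intro x y h
  exact hGi (congrArg Subtype.val h)
end

section
/- Let (n_i)_{i≥0} be a sequence of nonnegative integers with n_i → ∞, and for each i let φ_i : {0,…,n_{i+1}} → {0,…,n_i} be a surjection, inducing the affine map p_i : Δ^{n_{i+1}} → Δ^{n_i} defined by p_i(x)(j) = ∑_{φ_i(k)=j} x(k). Then the inverse limit lim(⋯ →^{p_1} Δ^{n_1} →^{p_0} Δ^{n_0}) = {(x_0,x_1,…) ∈ ∏_i Δ^{n_i} : p_i(x_{i+1}) = x_i for all i}, with the subspace topology of the product, contains a subspace homeomorphic to the Hilbert cube [0,1]^ℕ. (In particular, each Hilbert simplex of a Δ-space contains a copy of the Hilbert cube.) -/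
open unitInterval

theorem exists_thread_aux (i : ℕ) : ∀ (X : ℕ → Type) (φ : ∀ i, X (i + 1) → X i)
    (_ : ∀ i, Function.Surjective (φ i)) (j : X i),
    ∃ s : ∀ i, X i, (∀ i, φ i (s (i + 1)) = s i) ∧ s i = j := by
  induction i with
  | zero =>
    intro X φ hφ j
    refine ⟨fun i => Nat.rec j (fun k x => Function.surjInv (hφ k) x) i, fun i => ?_, rfl⟩
    exact Function.surjInv_eq (hφ i) _
  | succ i ih =>
    intro X φ hφ j
    obtain ⟨s, hs, hj⟩ := ih (fun i => X (i + 1)) (fun i => φ (i + 1)) (fun i => hφ (i + 1)) j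
    refine ⟨fun k => Nat.casesOn k (φ 0 (s 0)) s, fun k => ?_, hj⟩
    cases k with
    | zero => rfl
    | succ k => exact hs k

theorem thread_sep_aux (X : ℕ → Type) (φ : ∀ i, X (i + 1) → X i)
    (s t : ∀ i, X i) (hs : ∀ i, φ i (s (i + 1)) = s i) (ht : ∀ i, φ i (t (i + 1)) = t i)
    (h : s ≠ t) : ∀ᶠ i in Filter.atTop, s i ≠ t i := by
  obtain ⟨i, hi⟩ := Function.ne_iff.mp h
  filter_upwards [Filter.eventually_ge_atTop i] with k hk
  induction k, hk using Nat.le_induction with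
  | base => exact hi
  | succ k hk ih =>
    intro e
    apply ih
    rw [← hs, ← ht, e]

/-- the value of the point at level `i`, vertex `j`. -/
noncomputable def cubeTerm {X : ℕ → Type} [∀ i, DecidableEq (X i)] (a b : ℕ → ∀ i, X i)
    (t : ℕ → I) (i : ℕ) (j : X i) (m : ℕ) : ℝ :=
  (1 : ℝ) / 2 / 2 ^ m *
    ((t m : ℝ) * (if a m i = j then 1 else 0) + (1 - (t m : ℝ)) * (if b m i = j then 1 else 0))

section
variable {X : ℕ → Type} [∀ i, DecidableEq (X i)] (a b : ℕ → ∀ i, X i)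

theorem cubeTerm_nonneg (t : ℕ → I) (i : ℕ) (j : X i) (m : ℕ) : 0 ≤ cubeTerm a b t i j m := by
  have h0 := (t m).2.1
  have h1 : 0 ≤ 1 - (t m : ℝ) := sub_nonneg.mpr (t m).2.2
  unfold cubeTerm
  split_ifs <;> positivity

theorem cubeTerm_le (t : ℕ → I) (i : ℕ) (j : X i) (m : ℕ) :
    cubeTerm a b t i j m ≤ (1 : ℝ) / 2 / 2 ^ m := by
  have h0 := (t m).2.1
  have h1 := (t m).2.2
  unfold cubeTerm
  apply mul_le_of_le_one_right (by positivity)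
  split_ifs <;> linarith

theorem cubeTerm_norm_le (t : ℕ → I) (i : ℕ) (j : X i) (m : ℕ) :
    ‖cubeTerm a b t i j m‖ ≤ (1 : ℝ) / 2 / 2 ^ m := by
  rw [Real.norm_of_nonneg (cubeTerm_nonneg a b t i j m)]
  exact cubeTerm_le a b t i j m

theorem cubeTerm_summable (t : ℕ → I) (i : ℕ) (j : X i) : Summable (cubeTerm a b t i j) :=
  Summable.of_norm_bounded (summable_geometric_two' 1) (cubeTerm_norm_le a b t i j)

theorem cubeTerm_sum [∀ i, Fintype (X i)] (t : ℕ → I) (i : ℕ) :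
    ∑ j, ∑' m, cubeTerm a b t i j m = 1 := by
  rw [← Summable.tsum_finsetSum (fun j _ => cubeTerm_summable a b t i j), ← tsum_geometric_two' 1]
  congr 1
  ext m
  simp [cubeTerm, ← Finset.mul_sum, Finset.sum_add_distrib]

theorem cubeTerm_compat [∀ i, Fintype (X i)] (φ : ∀ i, X (i + 1) → X i)
    (ha : ∀ m i, φ i (a m (i + 1)) = a m i) (hb : ∀ m i, φ i (b m (i + 1)) = b m i)
    (t : ℕ → I) (i : ℕ) (j : X i) :
    ∑ k ∈ Finset.univ.filter (fun k => φ i k = j), ∑' m, cubeTerm a b t (i + 1) k m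
      = ∑' m, cubeTerm a b t i j m := by
  rw [← Summable.tsum_finsetSum (fun j _ => cubeTerm_summable a b t _ j)]
  congr 1
  ext m
  simp [cubeTerm, ← Finset.mul_sum, Finset.sum_add_distrib, ha, hb]

theorem cubeTerm_continuous (i : ℕ) (j : X i) :
    Continuous fun t : ℕ → I => ∑' m, cubeTerm a b t i j m := by
  refine continuous_tsum (fun m => ?_) (summable_geometric_two' 1)
    (fun m t => cubeTerm_norm_le a b t i j m)
  unfold cubeTerm
  fun_prop

theorem cubeTerm_tendsto (t : ℕ → I) (m : ℕ)
    (ha : ∀ k, k ≠ m → ∀ᶠ i in Filter.atTop, a k i ≠ a m i)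
    (hb : ∀ k, ∀ᶠ i in Filter.atTop, b k i ≠ a m i) :
    Filter.Tendsto (fun i => ∑' k, cubeTerm a b t i (a m i) k) Filter.atTop
      (nhds ((1 : ℝ) / 2 / 2 ^ m * t m)) := by
  rw [← tsum_ite_eq m (fun k => (1 : ℝ) / 2 / 2 ^ k * (t k : ℝ))]
  refine tendsto_tsum_of_dominated_convergence (summable_geometric_two' 1) (fun k => ?_)
    (Filter.Eventually.of_forall fun i k => cubeTerm_norm_le a b t i _ k)
  apply tendsto_const_nhds.congr'
  by_cases hk : k = m
  · subst hk
    filter_upwards [hb k] with i hi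
    simp [cubeTerm, hi]
  · filter_upwards [hb k, ha k hk] with i hi hi'
    simp [cubeTerm, hi, hi', hk]

end

/-- the inverse limit of an inverse sequence of affine maps of standard
simplexes induced by surjections of vertex sets, with dimensions tending to infinity,
contains a subspace homeomorphic to the Hilbert cube `[0,1]^ℕ`: there is a topological
embedding of the Hilbert cube into the limit. -/
theorem hilbertCube_embeds_in_limit_of_simplexes (n : ℕ → ℕ)
    (hn : Filter.Tendsto n Filter.atTop Filter.atTop)
    (φ : ∀ i, Fin (n (i + 1) + 1) → Fin (n i + 1))
    (hφ : ∀ i, Function.Surjective (φ i)) :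
    ∃ f : (ℕ → I) → {x : ∀ i, stdSimplex ℝ (Fin (n i + 1)) //
        ∀ i j, (∑ k ∈ Finset.univ.filter (fun k => φ i k = j), (x (i + 1)).1 k)
          = (x i).1 j},
      Topology.IsEmbedding f := by
  let T := {s : ∀ i, Fin (n i + 1) // ∀ i, φ i (s (i + 1)) = s i}
  have hT : Infinite T := by
    by_contra hfin
    rw [not_infinite_iff_finite] at hfin
    obtain ⟨i, hi⟩ := (hn.eventually_ge_atTop (Nat.card T)).exists
    have hsurj : Function.Surjective (fun s : T => s.1 i) := fun j => by
      obtain ⟨s, hs, hj⟩ := exists_thread_aux i (fun i => Fin (n i + 1)) φ hφ j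
      exact ⟨⟨s, hs⟩, hj⟩
    have := Nat.card_le_card_of_surjective _ hsurj
    simp at this
    omega
  let ξ := Infinite.natEmbedding T
  have hsep : ∀ p q, p ≠ q → ∀ᶠ i in Filter.atTop, (ξ p).1 i ≠ (ξ q).1 i := fun p q hpq =>
    thread_sep_aux (fun i => Fin (n i + 1)) φ _ _ (ξ p).2 (ξ q).2
      (fun h => hpq (ξ.injective (Subtype.ext h)))
  let a : ℕ → ∀ i, Fin (n i + 1) := fun m => (ξ (2 * m)).1
  let b : ℕ → ∀ i, Fin (n i + 1) := fun m => (ξ (2 * m + 1)).1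
  refine ⟨fun t => ⟨fun i => ⟨fun j => ∑' m, cubeTerm (X := fun i => Fin (n i + 1)) a b t i j m,
    fun j => tsum_nonneg (cubeTerm_nonneg (X := fun i => Fin (n i + 1)) a b t i j),
      cubeTerm_sum (X := fun i => Fin (n i + 1)) a b t i⟩,
    fun i j => cubeTerm_compat (X := fun i => Fin (n i + 1)) a b φ (fun m => (ξ (2 * m)).2)
      (fun m => (ξ (2 * m + 1)).2) t i j⟩, ?_⟩
  refine (Continuous.isClosedEmbedding ?_ ?_).isEmbedding
  · refine Continuous.subtype_mk (continuous_pi fun i => Continuous.subtype_mk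
      (continuous_pi fun j => ?_) _) _
    exact cubeTerm_continuous (X := fun i => Fin (n i + 1)) a b i j
  · intro t t' h
    funext m
    have key := fun t : ℕ → I => cubeTerm_tendsto (X := fun i => Fin (n i + 1)) a b t m
      (fun k hk => hsep _ _ (by omega)) (fun k => hsep _ _ (by omega))
    have he : ∀ i, ∑' k, cubeTerm (X := fun i => Fin (n i + 1)) a b t i (a m i) k
        = ∑' k, cubeTerm (X := fun i => Fin (n i + 1)) a b t' i (a m i) k := fun i =>
      congrFun (congrArg Subtype.val (congrFun (congrArg Subtype.val h) i)) (a m i)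
    have h2 := key t'
    simp only [← he] at h2
    have h3 := tendsto_nhds_unique (key t) h2
    exact Subtype.ext (mul_left_cancel₀ (by positivity) h3)
end

section
/- A metrizable topological space X is locally finite-dimensional if and only if X = ⋃_{n=1}^∞ X_n, where each X_n is a closed subset of X with covering dimension dim X_n ≤ n and X_n ⊆ Int X_{n+1}. -/
/-- Covering dimension at most `n`: every open cover has an open refinement in which
every point belongs to at most `n + 1` members. -/
def CovDimLE (X : Type*) [TopologicalSpace X] (n : ℕ) : Prop :=
  ∀ U : Set (Set X), (∀ u ∈ U, IsOpen u) → ⋃₀ U = Set.univ →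
    ∃ R : Set (Set X), (∀ v ∈ R, IsOpen v) ∧ ⋃₀ R = Set.univ ∧
      (∀ v ∈ R, ∃ u ∈ U, v ⊆ u) ∧ ∀ x : X, {v | v ∈ R ∧ x ∈ v}.encard ≤ (n : ℕ∞) + 1

/-- A space is finite-dimensional if its covering dimension is at most `n` for some `n`. -/
def FiniteDim (X : Type*) [TopologicalSpace X] : Prop := ∃ n, CovDimLE X n

/-- Locally finite-dimensional: every point has a finite-dimensional neighborhood. -/
def LocFinDim (X : Type*) [TopologicalSpace X] : Prop :=
  ∀ x : X, ∃ U ∈ nhds x, FiniteDim ↥U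

open Set Topology

universe u v

/-- Relative version of covering dimension. -/
def RelDim {X : Type u} [TopologicalSpace X] (n : ℕ) (C : Set X) : Prop :=
  ∀ (ι : Type u) (V : ι → Set X), (∀ i, IsOpen (V i)) → C ⊆ ⋃ i, V i →
    ∃ W : ι → Set X, (∀ i, IsOpen (W i)) ∧ (∀ i, W i ⊆ V i) ∧ C ⊆ ⋃ i, W i ∧
      ∀ x ∈ C, {i | x ∈ W i}.encard ≤ (n : ℕ∞) + 1

theorem relDim_of_covDim {X : Type u} [TopologicalSpace X] {n : ℕ} {C : Set X}
    (h : CovDimLE ↥C n) : RelDim n C := by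
  intro ι V hV hC
  obtain ⟨R, hRo, hRc, hRr, hRn⟩ := h (range fun i => ((↑) : C → X) ⁻¹' V i)
    (by rintro _ ⟨i, rfl⟩; exact (hV i).preimage continuous_subtype_val)
    (by
      rw [eq_univ_iff_forall]
      intro x
      obtain ⟨i, hi⟩ := mem_iUnion.1 (hC x.2)
      exact ⟨_, ⟨i, rfl⟩, hi⟩)
  have h1 : ∀ r : R, ∃ i, r.1 ⊆ ((↑) : C → X) ⁻¹' V i := by
    intro r
    obtain ⟨_, ⟨i, rfl⟩, hi⟩ := hRr r.1 r.2
    exact ⟨i, hi⟩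
  have h2 : ∀ r : R, ∃ O : Set X, IsOpen O ∧ ((↑) : C → X) ⁻¹' O = r.1 := fun r =>
    isOpen_induced_iff.1 (hRo r.1 r.2)
  choose f hf using h1
  choose O hO hOr using h2
  refine ⟨fun i => V i ∩ ⋃ r : {r : R // f r = i}, O r.1, ?_, ?_, ?_, ?_⟩
  · intro i
    exact (hV i).inter (isOpen_iUnion fun r => hO _)
  · intro i
    exact inter_subset_left
  · intro x hx
    have : (⟨x, hx⟩ : C) ∈ ⋃₀ R := by rw [hRc]; trivial
    obtain ⟨r, hr, hxr⟩ := this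
    refine mem_iUnion.2 ⟨f ⟨r, hr⟩, hf ⟨r, hr⟩ hxr, mem_iUnion.2 ⟨⟨⟨r, hr⟩, rfl⟩, ?_⟩⟩
    have h3 := hOr ⟨r, hr⟩
    have : (⟨x, hx⟩ : C) ∈ ((↑) : C → X) ⁻¹' O ⟨r, hr⟩ := by rw [h3]; exact hxr
    exact this
  · intro x hx
    have h4 : {i | x ∈ V i ∩ ⋃ r : {r : R // f r = i}, O r.1} ⊆
        f '' {r : R | (⟨x, hx⟩ : C) ∈ r.1} := by
      rintro i ⟨-, hi⟩
      obtain ⟨⟨r, rfl⟩, hr⟩ := mem_iUnion.1 hi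
      refine ⟨r, ?_, rfl⟩
      show (⟨x, hx⟩ : C) ∈ r.1
      rw [← hOr r]
      exact hr
    refine (encard_le_encard h4).trans ((encard_image_le _ _).trans ?_)
    rw [← Subtype.val_injective.encard_image]
    refine le_trans (encard_le_encard ?_) (hRn ⟨x, hx⟩)
    rintro _ ⟨r, hr, rfl⟩
    exact ⟨r.2, hr⟩

theorem covDim_of_relDim {X : Type u} [TopologicalSpace X] {n : ℕ} {C : Set X}
    (h : RelDim n C) : CovDimLE ↥C n := by
  intro U hU hUc
  have h2 : ∀ r : U, ∃ O : Set X, IsOpen O ∧ ((↑) : C → X) ⁻¹' O = r.1 := fun r =>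
    isOpen_induced_iff.1 (hU r.1 r.2)
  choose O hO hOr using h2
  obtain ⟨W, hWo, hWV, hWc, hWn⟩ := h U O hO (by
    intro x hx
    have : (⟨x, hx⟩ : C) ∈ ⋃₀ U := by rw [hUc]; trivial
    obtain ⟨r, hr, hxr⟩ := this
    have : (⟨x, hx⟩ : C) ∈ ((↑) : C → X) ⁻¹' O ⟨r, hr⟩ := by rw [hOr]; exact hxr
    exact mem_iUnion.2 ⟨⟨r, hr⟩, this⟩)
  refine ⟨range fun i => ((↑) : C → X) ⁻¹' W i, ?_, ?_, ?_, ?_⟩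
  · rintro _ ⟨i, rfl⟩
    exact (hWo i).preimage continuous_subtype_val
  · rw [eq_univ_iff_forall]
    intro x
    obtain ⟨i, hi⟩ := mem_iUnion.1 (hWc x.2)
    exact ⟨_, ⟨i, rfl⟩, hi⟩
  · rintro _ ⟨i, rfl⟩
    refine ⟨i.1, i.2, ?_⟩
    rw [← hOr i]
    exact preimage_mono (hWV i)
  · intro x
    refine le_trans ?_ (hWn x x.2)
    refine le_trans (encard_le_encard ?_)
      (encard_image_le (fun i => ((↑) : C → X) ⁻¹' W i) {i | (x : X) ∈ W i})
    rintro _ ⟨⟨i, rfl⟩, hi⟩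
    exact ⟨i, hi, rfl⟩

theorem RelDim.subset_closed {X : Type u} [TopologicalSpace X] {n : ℕ} {C D : Set X}
    (h : RelDim n C) (hD : IsClosed D) (hDC : D ⊆ C) : RelDim n D := by
  intro ι V hV hc
  rcases D.eq_empty_or_nonempty with rfl | ⟨x, hx⟩
  · exact ⟨V, hV, fun _ => subset_rfl, hc, fun x hx => hx.elim⟩
  obtain ⟨i0, -⟩ := mem_iUnion.1 (hc hx)
  obtain ⟨W, hWo, hWV, hWc, hWn⟩ := h ι (fun i => V i ∪ Dᶜ)
    (fun i => (hV i).union hD.isOpen_compl) (by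
      intro y hy
      by_cases hyD : y ∈ D
      · obtain ⟨i, hi⟩ := mem_iUnion.1 (hc hyD)
        exact mem_iUnion.2 ⟨i, Or.inl hi⟩
      · exact mem_iUnion.2 ⟨i0, Or.inr hyD⟩)
  refine ⟨fun i => W i ∩ V i, fun i => (hWo i).inter (hV i), fun i => inter_subset_right, ?_, ?_⟩
  · intro y hy
    obtain ⟨i, hi⟩ := mem_iUnion.1 (hWc (hDC hy))
    refine mem_iUnion.2 ⟨i, hi, ?_⟩
    rcases hWV i hi with h | h
    · exact h
    · exact (h hy).elim
  · intro y hy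
    exact (encard_le_encard fun i hi => hi.1).trans (hWn y (hDC hy))

theorem RelDim.mono {X : Type u} [TopologicalSpace X] {n m : ℕ} {C : Set X}
    (h : RelDim n C) (hnm : n ≤ m) : RelDim m C := by
  intro ι V hV hc
  obtain ⟨W, hWo, hWV, hWc, hWn⟩ := h ι V hV hc
  refine ⟨W, hWo, hWV, hWc, fun x hx => (hWn x hx).trans ?_⟩
  gcongr

theorem chain_bound {α : Type*} {S : Type*} (r : α → α → Prop) (T : α → Set S)
    (hr : ∀ a b, r a b → T a ⊆ T b) (hrefl : ∀ a, r a a) (c : Set α) (hc : IsChain r c)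
    (hne : c.Nonempty) (K : Set S) (hK : K.Finite) :
    ∃ a ∈ c, ∀ s ∈ K, (∃ b ∈ c, s ∈ T b) → s ∈ T a := by
  classical
  induction K, hK using Set.Finite.induction_on with
  | empty => obtain ⟨a, ha⟩ := hne; exact ⟨a, ha, by simp⟩
  | @insert s K _ _ ih =>
    obtain ⟨a, ha, h⟩ := ih
    by_cases hs : ∃ b ∈ c, s ∈ T b
    · obtain ⟨b, hb, hsb⟩ := hs
      have : r a b ∨ r b a := by
        by_cases hab : a = b
        · subst hab; exact Or.inl (hrefl a)
        · exact hc ha hb hab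
      rcases this with h1 | h1
      · refine ⟨b, hb, ?_⟩
        rintro t (rfl | ht) hex
        · exact hsb
        · exact hr _ _ h1 (h t ht hex)
      · refine ⟨a, ha, ?_⟩
        rintro t (rfl | ht) hex
        · exact hr _ _ h1 hsb
        · exact h t ht hex
    · refine ⟨a, ha, ?_⟩
      rintro t (rfl | ht) hex
      · exact (hs hex).elim
      · exact h t ht hex

theorem relDim_iUnion {X : Type u} [TopologicalSpace X] {n : ℕ} {S : Type v} {F : S → Set X}
    (hF : LocallyFinite F) (hFc : ∀ s, IsClosed (F s)) (hFn : ∀ s, RelDim n (F s)) :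
    RelDim n (⋃ s, F s) := by
  intro ι V hV hVc
  let P : Set S × (ι → Set X) → Prop := fun p =>
    (∀ i, IsOpen (p.2 i)) ∧ (∀ i, p.2 i ⊆ V i) ∧ (⋃ s, F s) ⊆ ⋃ i, p.2 i ∧
      ∀ s ∈ p.1, ∀ x ∈ F s, {i | x ∈ p.2 i}.encard ≤ (n : ℕ∞) + 1
  let r : {p // P p} → {p // P p} → Prop := fun a b =>
    a.1.1 ⊆ b.1.1 ∧ (∀ i, b.1.2 i ⊆ a.1.2 i) ∧
      ∀ i, ∀ x ∈ a.1.2 i, x ∉ b.1.2 i → ∃ s ∈ b.1.1, s ∉ a.1.1 ∧ x ∈ F s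
  have hrefl : ∀ a, r a a := fun a =>
    ⟨subset_rfl, fun i => subset_rfl, fun i x hx hx' => (hx' hx).elim⟩
  have htrans : ∀ {a b c}, r a b → r b c → r a c := by
    intro a b c hab hbc
    refine ⟨hab.1.trans hbc.1, fun i => (hbc.2.1 i).trans (hab.2.1 i), fun i x hx hx' => ?_⟩
    by_cases hb : x ∈ b.1.2 i
    · obtain ⟨s, hs, hs', hxs⟩ := hbc.2.2 i x hb hx'
      exact ⟨s, hs, fun h => hs' (hab.1 h), hxs⟩
    · obtain ⟨s, hs, hs', hxs⟩ := hab.2.2 i x hx hb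
      exact ⟨s, hbc.1 hs, hs', hxs⟩
  have hchain : ∀ c : Set {p // P p}, IsChain r c → ∃ ub, ∀ a ∈ c, r a ub := by
    intro c hc
    rcases c.eq_empty_or_nonempty with rfl | hne
    · exact ⟨⟨(∅, V), hV, fun i => subset_rfl, hVc, fun s hs => hs.elim⟩, fun a ha => ha.elim⟩
    have htot : ∀ a ∈ c, ∀ b ∈ c, r a b ∨ r b a := by
      intro a ha b hb
      by_cases hab : a = b
      · subst hab; exact Or.inl (hrefl a)
      · exact hc ha hb hab
    let T : Set S := {s | ∃ b ∈ c, s ∈ b.1.1}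
    let W : ι → Set X := fun i => {x | ∀ b ∈ c, x ∈ b.1.2 i}
    have key : ∀ x : X, ∃ a ∈ c, ∃ N ∈ 𝓝 x, ∀ y ∈ N, ∀ i, y ∈ a.1.2 i → y ∈ W i := by
      intro x
      obtain ⟨N, hN, hfin⟩ := hF x
      obtain ⟨a, ha, hK⟩ := chain_bound r (fun p => p.1.1) (fun a b h => h.1) hrefl c hc hne _ hfin
      refine ⟨a, ha, N, hN, fun y hy i hya b hb => ?_⟩
      rcases htot a ha b hb with h | h
      · by_contra hyb
        obtain ⟨s, hs, hs', hys⟩ := h.2.2 i y hya hyb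
        exact hs' (hK s ⟨y, hys, hy⟩ ⟨b, hb, hs⟩)
      · exact h.2.1 i hya
    refine ⟨⟨(T, W), ?_, ?_, ?_, ?_⟩, ?_⟩
    · intro i
      rw [isOpen_iff_mem_nhds]
      intro x hx
      obtain ⟨a, ha, N, hN, h⟩ := key x
      filter_upwards [hN, (a.2.1 i).mem_nhds (hx a ha)] with y hy hya
      exact h y hy i hya
    · intro i x hx
      obtain ⟨a, ha⟩ := hne
      exact a.2.2.1 i (hx a ha)
    · intro x hx
      obtain ⟨a, ha, N, hN, h⟩ := key x
      obtain ⟨i, hi⟩ := mem_iUnion.1 (a.2.2.2.1 hx)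
      exact mem_iUnion.2 ⟨i, h x (mem_of_mem_nhds hN) i hi⟩
    · rintro s ⟨b, hb, hs⟩ x hx
      have hsub : {i | x ∈ W i} ⊆ {i | x ∈ b.1.2 i} := fun i hi => hi b hb
      exact (encard_le_encard hsub).trans (b.2.2.2.2 s hs x hx)
    · intro a ha
      refine ⟨fun s hs => ⟨a, ha, hs⟩, fun i x hx => hx a ha, fun i x hx hx' => ?_⟩
      have : ∃ b ∈ c, x ∉ b.1.2 i := by
        by_contra hcon
        push Not at hcon
        exact hx' hcon
      obtain ⟨b, hb, hxb⟩ := this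
      rcases htot a ha b hb with h | h
      · obtain ⟨s, hs, hs', hxs⟩ := h.2.2 i x hx hxb
        exact ⟨s, ⟨b, hb, hs⟩, hs', hxs⟩
      · exact (hxb (h.2.1 i hx)).elim
  obtain ⟨m, hm⟩ := exists_maximal_of_chains_bounded hchain htrans
  have hall : ∀ s, s ∈ m.1.1 := by
    intro s
    by_contra hs
    obtain ⟨G, hGo, hGV, hGc, hGn⟩ := hFn s ι m.1.2 m.2.1
      ((subset_iUnion F s).trans m.2.2.2.1)
    have hsub : ∀ i, m.1.2 i ∩ ((F s)ᶜ ∪ G i) ⊆ m.1.2 i := fun i => inter_subset_left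
    let a : {p // P p} := ⟨(insert s m.1.1, fun i => m.1.2 i ∩ ((F s)ᶜ ∪ G i)), by
      refine ⟨fun i => (m.2.1 i).inter ((hFc s).isOpen_compl.union (hGo i)),
        fun i => (hsub i).trans (m.2.2.1 i), ?_, ?_⟩
      · intro x hx
        by_cases hxs : x ∈ F s
        · obtain ⟨i, hi⟩ := mem_iUnion.1 (hGc hxs)
          exact mem_iUnion.2 ⟨i, hGV i hi, Or.inr hi⟩
        · obtain ⟨i, hi⟩ := mem_iUnion.1 (m.2.2.2.1 hx)
          exact mem_iUnion.2 ⟨i, hi, Or.inl hxs⟩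
      · rintro t (rfl | ht) x hx
        · refine (encard_le_encard ?_).trans (hGn x hx)
          rintro i ⟨-, h | h⟩
          · exact (h hx).elim
          · exact h
        · exact (encard_le_encard fun i hi => hi.1).trans (m.2.2.2.2 t ht x hx)⟩
    have hma : r m a := by
      refine ⟨subset_insert _ _, hsub, fun i x hx hx' => ⟨s, mem_insert _ _, hs, ?_⟩⟩
      by_contra hxs
      exact hx' ⟨hx, Or.inl hxs⟩
    exact hs ((hm a hma).1 (mem_insert _ _))
  refine ⟨m.1.2, m.2.1, m.2.2.1, m.2.2.2.1, fun x hx => ?_⟩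
  obtain ⟨s, hs⟩ := mem_iUnion.1 hx
  exact m.2.2.2.2 s (hall s) x hs

theorem relDim_of_local {X : Type u} [TopologicalSpace X] [T2Space X] [ParacompactSpace X]
    {n : ℕ} {A : Set X} (hA : IsClosed A) (h : ∀ x ∈ A, ∃ N ∈ 𝓝 x, RelDim n N) :
    RelDim n A := by
  have h' : ∀ x : A, ∃ C ∈ 𝓝 (x : X), IsClosed C ∧ RelDim n C := by
    intro x
    obtain ⟨N, hN, hd⟩ := h x x.2
    obtain ⟨C, hC, hCc, hCN⟩ := exists_mem_nhds_isClosed_subset hN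
    exact ⟨C, hC, hCc, hd.subset_closed hCc hCN⟩
  choose C hC hCc hCd using h'
  obtain ⟨v, -, hvA, hvl, hvC⟩ := precise_refinement_set hA (fun x => interior (C x))
    (fun x => isOpen_interior)
    (fun x hx => mem_iUnion.2 ⟨⟨x, hx⟩, mem_interior_iff_mem_nhds.2 (hC ⟨x, hx⟩)⟩)
  have hl : LocallyFinite fun x => closure (v x) := hvl.closure
  refine (relDim_iUnion hl (fun s => isClosed_closure) fun s => (hCd s).subset_closed
    isClosed_closure (closure_minimal ((hvC s).trans interior_subset) (hCc s))).subset_closed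
    hA (hvA.trans (iUnion_mono fun s => subset_closure))

theorem locFinDim_iff_filtration {X : Type*} [TopologicalSpace X]
    [TopologicalSpace.MetrizableSpace X] :
    LocFinDim X ↔ ∃ A : ℕ → Set X, (⋃ n, A n) = Set.univ ∧
      ∀ n, IsClosed (A n) ∧ CovDimLE ↥(A n) (n + 1) ∧ A n ⊆ interior (A (n + 1)) := by
  constructor
  · intro hX
    let _ := TopologicalSpace.metrizableSpaceMetric X
    let U : ℕ → Set X := fun n => {x | ∃ N ∈ 𝓝 x, RelDim (n + 1) N}
    have hUo : ∀ n, IsOpen (U n) := by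
      intro n
      rw [isOpen_iff_mem_nhds]
      rintro x ⟨N, hN, hd⟩
      filter_upwards [eventually_mem_nhds_iff.2 hN] with y hy
      exact ⟨N, hy, hd⟩
    have hUm : Monotone U := by
      rintro n m hnm x ⟨N, hN, hd⟩
      exact ⟨N, hN, hd.mono (by omega)⟩
    have hUc : ∀ x, ∃ n, x ∈ U n := by
      intro x
      obtain ⟨N, hN, n, hn⟩ := hX x
      exact ⟨n, N, hN, (relDim_of_covDim hn).mono (by omega)⟩
    let A : ℕ → Set X := fun n => {x | ((n : ENNReal) + 1)⁻¹ ≤ Metric.infEDist x (U n)ᶜ}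
    have hAU : ∀ n, A n ⊆ U n := by
      intro n x hx
      by_contra hxU
      have h0 : Metric.infEDist x (U n)ᶜ = 0 := Metric.infEDist_zero_of_mem hxU
      have h1 : ((n : ENNReal) + 1)⁻¹ ≤ 0 := h0 ▸ hx
      have h2 : ((n : ENNReal) + 1)⁻¹ ≠ 0 := by
        rw [Ne, ENNReal.inv_eq_zero]
        exact_mod_cast ENNReal.natCast_ne_top (n + 1)
      exact h2 (le_antisymm h1 (zero_le))
    have hAc : ∀ n, IsClosed (A n) := fun n =>
      isClosed_le continuous_const Metric.continuous_infEDist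
    refine ⟨A, ?_, fun n => ⟨hAc n, ?_, ?_⟩⟩
    · rw [eq_univ_iff_forall]
      intro x
      obtain ⟨m, hm⟩ := hUc x
      have hpos : Metric.infEDist x (U m)ᶜ ≠ 0 := by
        intro h0
        have := (Metric.mem_iff_infEDist_zero_of_closed (hUo m).isClosed_compl).2 h0
        exact this hm
      obtain ⟨k, hk⟩ := ENNReal.exists_inv_nat_lt hpos
      refine mem_iUnion.2 ⟨max m k, ?_⟩
      calc (((max m k : ℕ) : ENNReal) + 1)⁻¹ ≤ (k : ENNReal)⁻¹ := by
            rw [ENNReal.inv_le_inv]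
            exact_mod_cast (le_max_right m k).trans (Nat.le_succ _)
        _ ≤ Metric.infEDist x (U m)ᶜ := hk.le
        _ ≤ Metric.infEDist x (U (max m k))ᶜ :=
            Metric.infEDist_anti (compl_subset_compl.2 (hUm (le_max_left m k)))
    · exact covDim_of_relDim (relDim_of_local (hAc n) (hAU n))
    · have hop : IsOpen {x | (((n + 1 : ℕ) : ENNReal) + 1)⁻¹ < Metric.infEDist x (U (n + 1))ᶜ} :=
        isOpen_lt continuous_const Metric.continuous_infEDist
      have hle : {x | (((n + 1 : ℕ) : ENNReal) + 1)⁻¹ < Metric.infEDist x (U (n + 1))ᶜ} ⊆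
          A (n + 1) := fun x hx => le_of_lt (mem_setOf_eq ▸ hx)
      refine subset_trans ?_ (interior_maximal hle hop)
      intro x hx
      have h1 : (((n + 1 : ℕ) : ENNReal) + 1)⁻¹ < ((n : ENNReal) + 1)⁻¹ := by
        rw [ENNReal.inv_lt_inv]
        exact_mod_cast Nat.lt_succ_self (n + 1)
      exact h1.trans_le (le_trans hx
        (Metric.infEDist_anti (compl_subset_compl.2 (hUm (Nat.le_succ n)))))
  · rintro ⟨A, hA, h⟩ x
    obtain ⟨n, hn⟩ := mem_iUnion.1 (hA ▸ mem_univ x : x ∈ ⋃ n, A n)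
    exact ⟨A (n + 1), mem_interior_iff_mem_nhds.1 ((h n).2.2 hn), _, (h (n + 1)).2.1⟩
end

section
/- Fix integers n ≥ m ≥ 0, and let Q = Q(m,n) be the abstract cell complex whose cells are the (m+1)-tuples (A_0,…,A_m) of nonempty subsets of {0,…,n} satisfying A_0 < A_1 < ⋯ < A_m (meaning max A_i < min A_{i+1} for each i), with face relation (B_0,…,B_m) ≤ (A_0,…,A_m) if and only if B_i ⊆ A_i for all i, and with the dimension of a cell (A_0,…,A_m) equal to (∑_i |A_i|) − (m+1). Then Q is collapsible onto its terminal vertex: the full set of cells can be reduced, by a finite sequence of elementary collapses (each removing a pair of cells (C, D) from the current down-closed set of cells, where dim D = dim C − 1, D ≤ C, and C is the only cell of the current set having D as a proper face), to the single 0-dimensional cell ({0},{1},…,{m}). -/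
/-- `CollapsesTo properFace dim P S T`: the set of cells `S` reduces to `T` by a finite
sequence of elementary collapses, each removing a pair `(C, D)` from the current set of
cells, where `D` is a facet of `C` (`properFace D C` and `dim D = dim C − 1`) and `C` is
the only cell of the current set having `D` as a proper face; every removed pair is
moreover required to satisfy the predicate `P C D`. -/
inductive CollapsesTo {α : Type*} (properFace : α → α → Prop) (dim : α → ℕ)
    (P : α → α → Prop) : Set α → Set α → Prop
  | refl (S : Set α) : CollapsesTo properFace dim P S S
  | step (S : Set α) (C D : α) (hC : C ∈ S) (hD : D ∈ S) (hDC : properFace D C)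
      (hdim : dim D + 1 = dim C)
      (hfree : ∀ C' ∈ S, properFace D C' → C' = C) (hP : P C D) (T : Set α)
      (h : CollapsesTo properFace dim P (S \ {C, D}) T) :
      CollapsesTo properFace dim P S T

/-- A cell of the complex `Q(m,n)`: an `(m+1)`-tuple `(A_0, …, A_m)` of nonempty subsets of
`{0, …, n}` with `A_0 < A_1 < ⋯ < A_m` (every element of `A_i` is less than every element
of `A_j` for `i < j`). -/
def GCell (m n : ℕ) : Type :=
  {A : Fin (m + 1) → Finset (Fin (n + 1)) // (∀ i, (A i).Nonempty) ∧
    ∀ i j : Fin (m + 1), i < j → ∀ a ∈ A i, ∀ b ∈ A j, a < b}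

/-- number of elements -/
def GCell.size {m n : ℕ} (A : GCell m n) : ℕ := ∑ i, (A.1 i).card

theorem GCell.size_ge {m n : ℕ} (A : GCell m n) : m + 1 ≤ A.size := by
  have : ∑ i : Fin (m+1), 1 ≤ A.size :=
    Finset.sum_le_sum (fun i _ => Finset.card_pos.mpr (A.2.1 i))
  simpa using this

theorem GCell.eq_of_size {m n : ℕ} (A B : GCell m n) (h : ∀ i, A.1 i ⊆ B.1 i)
    (hs : B.size ≤ A.size) : A = B := by
  apply Subtype.ext
  by_contra hne
  obtain ⟨i, hi⟩ := Function.ne_iff.mp hne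
  have : A.size < B.size := Finset.sum_lt_sum (fun i _ => Finset.card_le_card (h i))
    ⟨i, Finset.mem_univ i, Finset.card_lt_card (Finset.ssubset_iff_subset_ne.mpr ⟨h i, hi⟩)⟩
  omega

/-- first index where `A` differs from the terminal vertex -/
def GCell.First {m n : ℕ} (e : Fin (m+1) → Fin (n+1)) (i : Fin (m+1)) (A : GCell m n) : Prop :=
  (∀ j < i, A.1 j = {e j}) ∧ A.1 i ≠ {e i}

theorem GCell.First.unique {m n : ℕ} {e : Fin (m+1) → Fin (n+1)} {i j : Fin (m+1)}
    {A : GCell m n} (hi : A.First e i) (hj : A.First e j) : i = j := by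
  rcases lt_trichotomy i j with h | h | h
  · exact absurd (hj.1 i h) hi.2
  · exact h
  · exact absurd (hi.1 j h) hj.2

/-- toggling relation -/
def GCell.Tog {m n : ℕ} (e : Fin (m+1) → Fin (n+1)) (i : Fin (m+1)) (A B : GCell m n) : Prop :=
  B.1 = Function.update A.1 i (symmDiff (A.1 i) {e i})

theorem GCell.Tog.symm {m n : ℕ} {e : Fin (m+1) → Fin (n+1)} {i : Fin (m+1)}
    {A B : GCell m n} (h : A.Tog e i B) : B.Tog e i A := by
  unfold GCell.Tog at *
  rw [h]
  simp

theorem GCell.Tog.unique {m n : ℕ} {e : Fin (m+1) → Fin (n+1)} {i : Fin (m+1)}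
    {A B B' : GCell m n} (h : A.Tog e i B) (h' : A.Tog e i B') : B = B' :=
  Subtype.ext (Eq.trans h (Eq.symm h'))

theorem GCell.Tog.first {m n : ℕ} {e : Fin (m+1) → Fin (n+1)} {i : Fin (m+1)}
    {A B : GCell m n} (h : A.Tog e i B) (hA : A.First e i) : B.First e i := by
  unfold GCell.Tog at h
  refine ⟨fun j hj => ?_, fun hB => ?_⟩
  · rw [h, Function.update_of_ne hj.ne]; exact hA.1 j hj
  · rw [h, Function.update_self] at hB
    have h0 : A.1 i = ∅ := by
      have := symmDiff_eq_right.mp hB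
      simpa using this
    exact (A.2.1 i).ne_empty h0

theorem GCell.First.ge {m n : ℕ} {e : Fin (m+1) → Fin (n+1)} (he : ∀ i, (e i).val = i.val)
    {i : Fin (m+1)} {A : GCell m n} (hA : A.First e i) : ∀ a ∈ A.1 i, e i ≤ a := by
  intro a ha
  by_contra hlt
  have hlt : a.val < i.val := by
    have := not_le.mp hlt
    rw [Fin.lt_def, he] at this; exact this
  let j : Fin (m+1) := ⟨a.val, by omega⟩
  have hj : j < i := hlt
  have h1 := A.2.2 j i hj (e j) (by rw [hA.1 j hj]; simp) a ha
  rw [Fin.lt_def, he] at h1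
  exact lt_irrefl _ h1

theorem GCell.First.exists_tog {m n : ℕ} {e : Fin (m+1) → Fin (n+1)}
    (he : ∀ i, (e i).val = i.val)
    {i : Fin (m+1)} {A : GCell m n} (hA : A.First e i) : ∃ B, A.Tog e i B := by
  have hmem : ∀ a ∈ symmDiff (A.1 i) {e i}, a ∈ A.1 i ∨ a = e i := by
    intro a ha
    simp only [Finset.mem_symmDiff, Finset.mem_singleton] at ha
    tauto
  refine ⟨⟨Function.update A.1 i (symmDiff (A.1 i) {e i}), ?_, ?_⟩, rfl⟩
  · intro j
    by_cases hj : j = i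
    · subst hj
      rw [Function.update_self, Finset.nonempty_iff_ne_empty]
      intro h0
      exact hA.2 (symmDiff_eq_bot.mp h0)
    · rw [Function.update_of_ne hj]; exact A.2.1 j
  · intro j k hjk a ha b hb
    by_cases hj : j = i
    · subst hj
      rw [Function.update_self] at ha
      rw [Function.update_of_ne hjk.ne'] at hb
      rcases hmem a ha with ha | rfl
      · exact A.2.2 _ _ hjk a ha b hb
      · obtain ⟨c, hc⟩ := A.2.1 j
        exact (hA.ge he c hc).trans_lt (A.2.2 _ _ hjk c hc b hb)
    · rw [Function.update_of_ne hj] at ha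
      by_cases hk : k = i
      · subst hk
        rw [Function.update_self] at hb
        rcases hmem b hb with hb | rfl
        · exact A.2.2 _ _ hjk a ha b hb
        · rw [hA.1 j hjk, Finset.mem_singleton] at ha
          subst ha
          rw [Fin.lt_def, he, he]; exact hjk
      · rw [Function.update_of_ne hk] at hb
        exact A.2.2 _ _ hjk a ha b hb

theorem GCell.Tog.add {m n : ℕ} {e : Fin (m+1) → Fin (n+1)} {i : Fin (m+1)}
    {A B : GCell m n} (h : A.Tog e i B) (hi : e i ∉ A.1 i) :
    (∀ j, A.1 j ⊆ B.1 j) ∧ B.size = A.size + 1 ∧ B.1 i = insert (e i) (A.1 i) := by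
  have hs : symmDiff (A.1 i) {e i} = insert (e i) (A.1 i) := by
    ext a
    simp only [Finset.mem_symmDiff, Finset.mem_singleton, Finset.mem_insert]
    constructor
    · tauto
    · rintro (rfl | h)
      · exact Or.inr ⟨rfl, hi⟩
      · exact Or.inl ⟨h, fun h' => hi (h' ▸ h)⟩
  unfold GCell.Tog at h
  rw [hs] at h
  refine ⟨fun j => ?_, ?_, ?_⟩
  · rw [h]
    by_cases hj : j = i
    · subst hj; simp
    · rw [Function.update_of_ne hj]
  · unfold GCell.size
    rw [← Finset.add_sum_erase _ _ (Finset.mem_univ i),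
      ← Finset.add_sum_erase _ (fun j => (A.1 j).card) (Finset.mem_univ i)]
    have : ∑ x ∈ Finset.univ.erase i, (B.1 x).card = ∑ x ∈ Finset.univ.erase i, (A.1 x).card := by
      apply Finset.sum_congr rfl
      intro x hx
      rw [h, Function.update_of_ne (Finset.ne_of_mem_erase hx)]
    rw [this, h, Function.update_self, Finset.card_insert_of_notMem hi]
    omega
  · rw [h, Function.update_self]

theorem GCell.exists_first {m n : ℕ} (e : Fin (m+1) → Fin (n+1)) (A : GCell m n)
    (hA : A.1 ≠ fun i => {e i}) : ∃ i, A.First e i := by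
  obtain ⟨i, hi⟩ := Function.ne_iff.mp hA
  induction i using WellFoundedLT.induction with
  | ind i ih =>
    by_cases hh : ∃ j < i, A.1 j ≠ {e j}
    · obtain ⟨j, hj, hj'⟩ := hh
      exact ih j hj hj'
    · push Not at hh
      exact ⟨i, hh, hi⟩

instance {m n : ℕ} : Finite (GCell m n) := by unfold GCell; infer_instance

theorem GCell.collapse_aux {m n : ℕ} (e : Fin (m+1) → Fin (n+1)) (he : ∀ i, (e i).val = i.val)
    (t : GCell m n) (ht : t.1 = fun i => {e i}) (N : ℕ) :
    ∀ S : Set (GCell m n), S.ncard ≤ N → t ∈ S →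
    (∀ A B i, A.First e i → A.Tog e i B → A ∈ S → B ∈ S) →
    CollapsesTo (fun D C : GCell m n => (∀ i, D.1 i ⊆ C.1 i) ∧ D ≠ C)
      (fun C : GCell m n => (∑ i, (C.1 i).card) - (m + 1))
      (fun _ _ => True) S {t} := by
  induction N with
  | zero =>
    intro S hS htS _
    rw [Nat.le_zero, Set.ncard_eq_zero] at hS
    simp [hS] at htS
  | succ N ih =>
    intro S hS htS hcl
    by_cases hSt : S = {t}
    · rw [hSt]; exact CollapsesTo.refl _
    have htF : ∀ i, ¬ t.First e i := fun i hi => hi.2 (by rw [ht])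
    have hne : ∃ A ∈ S, A ≠ t := by
      by_contra hh
      push Not at hh
      exact hSt (Set.eq_singleton_iff_unique_mem.mpr ⟨htS, hh⟩)
    have hfirst : ∀ A : GCell m n, A ≠ t → ∃ i, A.First e i := fun A hA =>
      A.exists_first e (fun h' => hA (Subtype.ext (h'.trans ht.symm)))
    -- minimal index
    obtain ⟨i, ⟨A0, hA0S, hA0⟩, hmin⟩ : ∃ i, (∃ A ∈ S, A.First e i) ∧
        ∀ j, (∃ A ∈ S, A.First e j) → i ≤ j := by
      obtain ⟨A, hAS, hAt⟩ := hne
      obtain ⟨i, hi⟩ := hfirst A hAt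
      obtain ⟨i, hi, hm⟩ := Set.exists_min_image {i | ∃ A ∈ S, A.First e i} id
        (Set.toFinite _) ⟨i, A, hAS, hi⟩
      exact ⟨i, hi, hm⟩
    obtain ⟨C, ⟨hCS, hCF⟩, hmax⟩ := Set.exists_max_image {A | A ∈ S ∧ A.First e i} GCell.size
        (Set.toFinite _) ⟨A0, hA0S, hA0⟩
    have hmem : ∀ A ∈ S, A.First e i → C.size ≤ A.size → e i ∈ A.1 i := by
      intro A hAS hAF hsz
      by_contra hni
      obtain ⟨B, hB⟩ := hAF.exists_tog he
      have h1 := hmax B ⟨hcl A B i hAF hB hAS, hB.first hAF⟩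
      have h2 := (hB.add hni).2.1
      omega
    have hiC := hmem C hCS hCF le_rfl
    obtain ⟨D, hCD⟩ := hCF.exists_tog he
    have hDF := hCD.first hCF
    have hDS := hcl C D i hCF hCD hCS
    have hiD : e i ∉ D.1 i := by
      have : D.1 = _ := hCD
      rw [this, Function.update_self]
      simp [Finset.mem_symmDiff, hiC]
    obtain ⟨hsub, hsize, hins⟩ := hCD.symm.add hiD
    have hDsz := D.size_ge
    have hDC : D ≠ C := by
      intro h'; rw [h'] at hsize; omega
    refine CollapsesTo.step S C D hCS hDS ⟨hsub, hDC⟩ ?_ ?_ trivial _ (ih _ ?_ ?_ ?_)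
    · change D.size - (m+1) + 1 = C.size - (m+1)
      omega
    · rintro C' hC'S ⟨hDC', hDne⟩
      have hlt : D.size < C'.size := by
        by_contra hh
        exact hDne (GCell.eq_of_size D C' hDC' (not_lt.mp hh))
      have hC't : C' ≠ t := by
        rintro rfl
        have : C'.size = m + 1 := by unfold GCell.size; rw [ht]; simp
        omega
      obtain ⟨j, hj⟩ := hfirst C' hC't
      have hij := hmin j ⟨C', hC'S, hj⟩
      have hji : j = i := by
        by_contra hne
        have hlt' : i < j := lt_of_le_of_ne hij (Ne.symm hne)
        have h1 := hDC' i
        rw [hj.1 i hlt'] at h1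
        obtain ⟨a, ha⟩ := D.2.1 i
        have := Finset.mem_singleton.mp (h1 ha)
        exact hiD (this ▸ ha)
      subst hji
      have hC'm := hmem C' hC'S hj (by omega)
      have hle := hmax C' ⟨hC'S, hj⟩
      symm
      apply GCell.eq_of_size C C' _ hle
      intro k
      by_cases hk : k = j
      · subst hk
        rw [hins]
        exact Finset.insert_subset hC'm (hDC' k)
      · have : D.1 = _ := hCD
        have h2 := hDC' k
        rwa [this, Function.update_of_ne hk] at h2
    · have : (S \ {C, D}).ncard < S.ncard :=
        Set.ncard_lt_ncard ⟨Set.sdiff_subset, fun h' => (h' hCS).2 (by simp)⟩ (Set.toFinite _)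
      omega
    · refine ⟨htS, ?_⟩
      rintro (rfl | rfl)
      · exact htF i hCF
      · exact htF i hDF
    · rintro A B k hAk hAB ⟨hAS, hAn⟩
      refine ⟨hcl A B k hAk hAB hAS, ?_⟩
      have hBk := hAB.first hAk
      rintro (rfl | rfl)
      · obtain rfl := hBk.unique hCF
        exact hAn (Or.inr (hAB.symm.unique hCD))
      · obtain rfl := hBk.unique hDF
        exact hAn (Or.inl (hAB.symm.unique hCD.symm))

/-- the cell complex `Q(m,n)` is collapsible onto its terminal vertex: the
full set of cells reduces by a finite sequence of elementary collapses to the single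
`0`-dimensional cell `({0}, {1}, …, {m})`. -/
theorem gcell_complex_collapsible (m n : ℕ) (h : m ≤ n) :
    CollapsesTo (fun D C : GCell m n => (∀ i, D.1 i ⊆ C.1 i) ∧ D ≠ C)
      (fun C : GCell m n => (∑ i, (C.1 i).card) - (m + 1))
      (fun _ _ => True)
      Set.univ
      {⟨fun i => {Fin.castLE (Nat.succ_le_succ h) i}, fun i => Finset.singleton_nonempty _,
        by
          intro i j hij a ha b hb
          simp only [Finset.mem_singleton] at ha hb
          subst ha; subst hb
          exact hij⟩} := by
  exact GCell.collapse_aux (fun i => Fin.castLE (Nat.succ_le_succ h) i) (fun i => rfl) _ rfl _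
    Set.univ le_rfl (Set.mem_univ _) (fun _ _ _ _ _ _ => Set.mem_univ _)
end

section
/- Let X_∞ be a topological space which is the union of a chain X_0 ⊆ X_1 ⊆ ⋯ of subspaces, and for each i ≥ 0 let h^i : X_{i+1} × [0,1] → X_{i+1} be a strong deformation retraction of X_{i+1} onto X_i, with r_i : X_{i+1} → X_i the retraction r_i(x) = h^i(x,1). For k ≥ i ≥ 0 let r^k_i = r_i ∘ ⋯ ∘ r_{k−1} : X_k → X_i, and let r^∞_i : X_∞ → X_i be the (well-defined) map with r^∞_i(x) = r^k_i(x) whenever x ∈ X_k, k ≥ i. Define H : X_∞ × [0,1] → X_∞ by H(x,0) = x and, for t ∈ [0,1] and i ≥ 0, H(x, 2^{−i−1} + t·2^{−i−1}) = h^i(r^∞_{i+1}(x), t) (so that H(x, 2^{−i}) = r^∞_i(x)). If for each i ≥ 0 the restriction of H to X_∞ × [0, 2^{−i}] is continuous at each point of X_i × [0, 2^{−i}], then H is continuous, and hence H is a strong deformation retraction of X_∞ onto X_0. -/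
/-- `rcompAux r i d = r_i ∘ ⋯ ∘ r_{i+d-1}` : the finite composition of the retractions
`r_j`, applied to points of `X_{i+d}` and landing in `X_i`. -/
def rcompAux {X : Type*} (r : ℕ → X → X) (i : ℕ) : ℕ → X → X
  | 0, x => x
  | d + 1, x => rcompAux r i d (r (i + d) x)

/-- let `X_∞ = ⋃ X_i` with each `X_{i+1}` strongly deformation retracting
onto `X_i` via `h^i`, let `r^∞_i : X_∞ → X_i` be the infinite composites of the
retractions, and let `H` be the infinite composition of the deformation retractions
(`H(x, 2^{−i−1}(1+t)) = h^i(r^∞_{i+1}(x), t)`, `H(x,0) = x`). If for each `i` the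
restriction of `H` to `X_∞ × [0, 2^{−i}]` is continuous at each point of
`X_i × [0, 2^{−i}]`, then `H` is continuous, and hence `H` is a strong deformation
retraction of `X_∞` onto `X_0`. -/
theorem infinite_composition_continuous {X : Type*} [TopologicalSpace X]
    (A : ℕ → Set X) (hA : ∀ i, A i ⊆ A (i + 1)) (hU : (⋃ i, A i) = Set.univ)
    (h : ℕ → X → ℝ → X)
    (hmap : ∀ i, ∀ x ∈ A (i + 1), ∀ t ∈ Set.Icc (0:ℝ) 1, h i x t ∈ A (i + 1))
    (hcont : ∀ i, ContinuousOn (fun p : X × ℝ => h i p.1 p.2)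
      ((A (i + 1)) ×ˢ Set.Icc (0:ℝ) 1))
    (h0 : ∀ i, ∀ x ∈ A (i + 1), h i x 0 = x)
    (h1 : ∀ i, ∀ x ∈ A (i + 1), h i x 1 ∈ A i)
    (hfix : ∀ i, ∀ x ∈ A i, ∀ t ∈ Set.Icc (0:ℝ) 1, h i x t = x)
    (R : ℕ → X → X)
    (hR : ∀ i k, i ≤ k → ∀ x ∈ A k,
      R i x = rcompAux (fun j y => h j y 1) i (k - i) x)
    (H : X × ℝ → X)
    (hH0 : ∀ x, H (x, 0) = x)
    (hHdef : ∀ i, ∀ t ∈ Set.Icc (0:ℝ) 1, ∀ x,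
      H (x, (1 + t) / 2 ^ (i + 1)) = h i (R (i + 1) x) t)
    (hcontAt : ∀ i, ∀ x ∈ A i, ∀ s ∈ Set.Icc (0:ℝ) ((2 ^ i : ℝ)⁻¹),
      ContinuousWithinAt H (Set.univ ×ˢ Set.Icc (0:ℝ) ((2 ^ i : ℝ)⁻¹)) (x, s)) :
    ContinuousOn H (Set.univ ×ˢ Set.Icc (0:ℝ) 1) ∧
    (∀ x, H (x, 1) ∈ A 0) ∧
    (∀ x ∈ A 0, ∀ t ∈ Set.Icc (0:ℝ) 1, H (x, t) = x) := by
  have hmono : Monotone A := monotone_nat_of_le_succ hA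
  have hex : ∀ x, ∃ k, x ∈ A k := fun x => by
    have : x ∈ ⋃ i, A i := hU ▸ Set.mem_univ x
    exact Set.mem_iUnion.1 this
  have hcomp : ∀ i d, ∀ x ∈ A (i + d), rcompAux (fun j y => h j y 1) i d x ∈ A i := by
    intro i d
    induction d with
    | zero => intro x hx; exact hx
    | succ d ih => intro x hx; exact ih _ (h1 (i + d) x hx)
  have hRmem : ∀ i x, R i x ∈ A i := by
    intro i x
    obtain ⟨k, hk⟩ := hex x
    have hk' : x ∈ A (i + k) := hmono (Nat.le_add_left k i) hk
    rw [hR i (i + k) (Nat.le_add_right i k) x hk', Nat.add_sub_cancel_left]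
    exact hcomp i k x hk'
  have hRfix : ∀ i, ∀ x ∈ A i, R i x = x := by
    intro i x hx
    rw [hR i i le_rfl x hx, Nat.sub_self]
    rfl
  have hHR : ∀ i x, H (x, (2 ^ (i + 1) : ℝ)⁻¹) = R (i + 1) x := by
    intro i x
    have := hHdef i 0 (by simp) x
    rw [h0 i _ (hRmem _ _)] at this
    rw [← this]
    congr 2
    simp
  -- reparametrization
  have hpar : ∀ i (s : ℝ), s ∈ Set.Icc ((2 ^ (i + 1) : ℝ)⁻¹) ((2 ^ i : ℝ)⁻¹) →
      (2 ^ (i + 1) * s - 1) ∈ Set.Icc (0:ℝ) 1 ∧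
      ∀ x, H (x, s) = h i (R (i + 1) x) (2 ^ (i + 1) * s - 1) := by
    intro i s hs
    have hp : (0:ℝ) < 2 ^ i := by positivity
    have hp' : (0:ℝ) < 2 ^ (i + 1) := by positivity
    have ha : (1:ℝ) ≤ 2 ^ (i + 1) * s := by
      have := mul_le_mul_of_nonneg_left hs.1 hp'.le
      rwa [mul_inv_cancel₀ hp'.ne'] at this
    have hb : (2:ℝ) ^ i * s ≤ 1 := by
      have := mul_le_mul_of_nonneg_left hs.2 hp.le
      rwa [mul_inv_cancel₀ hp.ne'] at this
    have hmem : (2 ^ (i + 1) * s - 1) ∈ Set.Icc (0:ℝ) 1 := by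
      refine ⟨by linarith, ?_⟩
      rw [pow_succ]
      linarith
    refine ⟨hmem, fun x => ?_⟩
    rw [← hHdef i _ hmem x]
    congr 2
    field_simp
    ring
  have key : ∀ k, ∀ x ∈ A k, ∀ d i, i + d = k → ∀ s ∈ Set.Icc (0:ℝ) ((2 ^ i : ℝ)⁻¹),
      ContinuousWithinAt H (Set.univ ×ˢ Set.Icc (0:ℝ) ((2 ^ i : ℝ)⁻¹)) (x, s) := by
    intro k x hx d
    induction d with
    | zero =>
      intro i hi s hs
      obtain rfl : i = k := by simpa using hi
      exact hcontAt i x hx s hs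
    | succ d ih =>
      intro i hi s hs
      have IH := ih (i + 1) (by omega)
      have hle : ((2:ℝ) ^ (i + 1))⁻¹ ≤ (2 ^ i)⁻¹ := by
        apply inv_anti₀ (by positivity)
        exact pow_le_pow_right₀ (by norm_num) (Nat.le_succ i)
      have hpos : (0:ℝ) ≤ ((2:ℝ) ^ (i + 1))⁻¹ := by positivity
      rw [← Set.Icc_union_Icc_eq_Icc hpos hle, Set.prod_union]
      refine ContinuousWithinAt.union ?_ ?_
      · by_cases hs1 : s ≤ ((2:ℝ) ^ (i + 1))⁻¹
        · exact IH s ⟨hs.1, hs1⟩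
        · apply continuousWithinAt_of_notMem_closure
          rw [(isClosed_univ.prod isClosed_Icc).closure_eq]
          exact fun hm => hs1 hm.2.2
      · by_cases hs1 : ((2:ℝ) ^ (i + 1))⁻¹ ≤ s
        · have hRc : ContinuousAt (R (i + 1)) x := by
            have hc := IH _ ⟨hpos, le_rfl⟩
            have hg : ContinuousWithinAt (fun y : X => (y, ((2:ℝ) ^ (i + 1))⁻¹)) Set.univ x :=
              (by fun_prop : Continuous (fun y : X => (y, ((2:ℝ) ^ (i + 1))⁻¹))).continuousWithinAt
            have := ContinuousWithinAt.comp (f := fun y : X => (y, ((2:ℝ) ^ (i + 1))⁻¹))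
              hc hg (fun y _ => ⟨Set.mem_univ _, hpos, le_rfl⟩)
            rw [continuousWithinAt_univ] at this
            refine this.congr (Filter.Eventually.of_forall fun y => ?_)
            exact hHR i y
          have hs2 : s ∈ Set.Icc ((2 ^ (i + 1) : ℝ)⁻¹) ((2 ^ i : ℝ)⁻¹) := ⟨hs1, hs.2⟩
          have hh := hcont i (R (i + 1) x, 2 ^ (i + 1) * s - 1)
            ⟨hRmem _ _, (hpar i s hs2).1⟩
          have hg : ContinuousAt
              (fun p : X × ℝ => (R (i + 1) p.1, (2:ℝ) ^ (i + 1) * p.2 - 1)) (x, s) := by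
            refine ContinuousAt.prodMk ?_ (by fun_prop)
            exact ContinuousAt.comp (f := Prod.fst) (x := (x, s)) hRc continuousAt_fst
          have hc := ContinuousWithinAt.comp
            (f := fun p : X × ℝ => (R (i + 1) p.1, (2:ℝ) ^ (i + 1) * p.2 - 1))
            (x := (x, s)) (s := Set.univ ×ˢ Set.Icc ((2 ^ (i + 1) : ℝ)⁻¹) ((2 ^ i : ℝ)⁻¹))
            hh hg.continuousWithinAt
            (fun p hp => ⟨hRmem _ _, (hpar i p.2 hp.2).1⟩)
          exact hc.congr (fun p hp => (hpar i p.2 hp.2).2 p.1) ((hpar i s hs2).2 x)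
        · apply continuousWithinAt_of_notMem_closure
          rw [(isClosed_univ.prod isClosed_Icc).closure_eq]
          exact fun hm => hs1 hm.2.1
  refine ⟨?_, ?_, ?_⟩
  · rintro ⟨x, s⟩ ⟨-, hs⟩
    obtain ⟨k, hk⟩ := hex x
    have := key k x hk k 0 (by simp) s (by simpa using hs)
    simpa using this
  · intro x
    have := hHdef 0 1 (by simp) x
    have e : ((1:ℝ) + 1) / 2 ^ (0 + 1) = 1 := by norm_num
    rw [e] at this
    rw [this]
    exact h1 0 _ (hRmem _ _)
  · intro x hx t ht
    rcases ht.1.eq_or_lt with rfl | hpos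
    · exact hH0 x
    · obtain ⟨n, hn1, hn2⟩ := exists_nat_pow_near_of_lt_one hpos ht.2
        (by norm_num : (0:ℝ) < 2⁻¹) (by norm_num)
      rw [inv_pow] at hn1 hn2
      obtain ⟨hm, he⟩ := hpar n t ⟨hn1.le, hn2⟩
      rw [he x, hRfix (n + 1) x (hmono (Nat.zero_le _) hx)]
      exact hfix n x (hmono (Nat.zero_le _) hx) _ hm
end
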